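/- Let a, b, c, d be nonzero real numbers with c, d > 0. For any i.i.d. real-valued random variables X, Y, P(|aX + bY| ≤ c) ≤ (1/2)(⌈2c/(|a|d)⌉ + ⌈2c/(|b|d)⌉) · P(|X − Y| ≤ d). -/

import Mathlib

open MeasureTheory ProbabilityTheory
open scoped ENNReal

/-- The reciprocal of the mass of a closed ball of radius `d` has integral at most one over any
interval of length `d`. -/
lemma setLIntegral_inv_measure_closedBall_Icc_le_one (ν : Measure ℝ) [IsFiniteMeasure ν]
    (s d : ℝ) :
    ∫⁻ x in Set.Icc s (s + d), (ν (Metric.closedBall x d))⁻¹ ∂ν ≤ 1 := by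
  calc ∫⁻ x in Set.Icc s (s + d), (ν (Metric.closedBall x d))⁻¹ ∂ν
      ≤ ∫⁻ _ in Set.Icc s (s + d), (ν (Set.Icc s (s + d)))⁻¹ ∂ν := by
        refine setLIntegral_mono measurable_const fun x hx => ?_
        refine ENNReal.inv_le_inv.2 (measure_mono fun y hy => ?_)
        rw [Metric.mem_closedBall, Real.dist_eq, abs_le]
        constructor <;> linarith [hx.1, hx.2, hy.1, hy.2]
    _ = (ν (Set.Icc s (s + d)))⁻¹ * ν (Set.Icc s (s + d)) := setLIntegral_const _ _
    _ ≤ 1 := ENNReal.inv_mul_le_one _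

lemma Icc_add_nat_mul_subset_iUnion (s d : ℝ) (hd : 0 < d) {m : ℕ} (hm : 0 < m) :
    Set.Icc s (s + m * d) ⊆ ⋃ j : Fin m, Set.Icc (s + j * d) (s + j * d + d) := by
  intro x hx
  rw [Set.mem_iUnion]
  have h0 : 0 ≤ (x - s) / d := div_nonneg (by linarith [hx.1]) hd.le
  have key : (x - s) / d * d = x - s := div_mul_cancel₀ _ hd.ne'
  by_cases hlt : ⌊(x - s) / d⌋₊ < m
  · refine ⟨⟨_, hlt⟩, ?_, ?_⟩
    · have := mul_le_mul_of_nonneg_right (Nat.floor_le h0) hd.le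
      simp only
      linarith
    · have := mul_le_mul_of_nonneg_right (Nat.lt_floor_add_one ((x - s) / d)).le hd.le
      simp only
      linarith
  · have hge : (m : ℝ) ≤ (x - s) / d := (Nat.le_floor_iff h0).1 (not_lt.1 hlt)
    have h1 := mul_le_mul_of_nonneg_right hge hd.le
    have hcast : ((m - 1 : ℕ) : ℝ) = m - 1 := by
      rw [Nat.cast_sub hm, Nat.cast_one]
    refine ⟨⟨m - 1, by omega⟩, ?_, ?_⟩ <;> simp only [hcast] <;> linarith [hx.2]

lemma setLIntegral_inv_measure_closedBall_abs_le (ν : Measure ℝ) [IsFiniteMeasure ν]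
    {a c d : ℝ} (t : ℝ) (ha : a ≠ 0) (hc : 0 < c) (hd : 0 < d) :
    ∫⁻ x in {x | |a * x + t| ≤ c}, (ν (Metric.closedBall x d))⁻¹ ∂ν ≤
      (⌈2 * c / (|a| * d)⌉₊ : ℝ≥0∞) := by
  have ha' : 0 < |a| := abs_pos.2 ha
  have hm : 0 < ⌈2 * c / (|a| * d)⌉₊ := Nat.ceil_pos.2 (by positivity)
  have hle := Nat.le_ceil (2 * c / (|a| * d))
  set m := ⌈2 * c / (|a| * d)⌉₊
  have hlen : 2 * (c / |a|) ≤ m * d := by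
    calc 2 * (c / |a|) = 2 * c / (|a| * d) * d := by field_simp
      _ ≤ m * d := by gcongr
  have hsub : {x | |a * x + t| ≤ c} ⊆
      Set.Icc (-t / a - c / |a|) (-t / a - c / |a| + m * d) := by
    intro x hx
    have h : |x - -t / a| ≤ c / |a| := by
      rw [le_div_iff₀ ha', ← abs_mul]
      have hmul : (x - -t / a) * a = a * x + t := by
        field_simp
        ring
      rw [hmul]
      exact hx
    rw [abs_le] at h
    constructor <;> linarith [h.1, h.2]
  calc ∫⁻ x in {x | |a * x + t| ≤ c}, (ν (Metric.closedBall x d))⁻¹ ∂ν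
      ≤ ∫⁻ x in ⋃ j : Fin m, Set.Icc (-t / a - c / |a| + j * d) (-t / a - c / |a| + j * d + d),
          (ν (Metric.closedBall x d))⁻¹ ∂ν :=
        lintegral_mono_set (hsub.trans (Icc_add_nat_mul_subset_iUnion _ d hd hm))
    _ ≤ ∑' j : Fin m, ∫⁻ x in Set.Icc (-t / a - c / |a| + j * d) (-t / a - c / |a| + j * d + d),
          (ν (Metric.closedBall x d))⁻¹ ∂ν := lintegral_iUnion_le _ _
    _ ≤ ∑' _ : Fin m, 1 :=
        ENNReal.tsum_le_tsum fun j => setLIntegral_inv_measure_closedBall_Icc_le_one ν _ d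
    _ = m := by simp

lemma measurable_measure_closedBall (ν : Measure ℝ) [SFinite ν] (d : ℝ) :
    Measurable fun x => ν (Metric.closedBall x d) := by
  have hs : MeasurableSet {p : ℝ × ℝ | |p.2 - p.1| ≤ d} :=
    measurableSet_le (by fun_prop) measurable_const
  exact measurable_measure_prodMk_left hs

lemma ae_measure_closedBall_ne_zero (ν : Measure ℝ) {d : ℝ} (hd : 0 < d) :
    ∀ᵐ x ∂ν, ν (Metric.closedBall x d) ≠ 0 := by
  filter_upwards [Measure.support_mem_ae (μ := ν)] with x hx
  exact ((Measure.mem_support_iff_forall _).1 hx _ (Metric.closedBall_mem_nhds x hd)).ne'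

lemma setLIntegral_prod_inv_mul_measure_closedBall_le (ν : Measure ℝ) [IsFiniteMeasure ν]
    {a c d : ℝ} (b : ℝ) (ha : a ≠ 0) (hc : 0 < c) (hd : 0 < d) :
    ∫⁻ p in {p : ℝ × ℝ | |a * p.1 + b * p.2| ≤ c},
        (ν (Metric.closedBall p.1 d))⁻¹ * ν (Metric.closedBall p.2 d) ∂(ν.prod ν) ≤
      (⌈2 * c / (|a| * d)⌉₊ : ℝ≥0∞) * ∫⁻ y, ν (Metric.closedBall y d) ∂ν := by
  have hf := measurable_measure_closedBall ν d
  have hK : MeasurableSet {p : ℝ × ℝ | |a * p.1 + b * p.2| ≤ c} :=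
    measurableSet_le (by fun_prop) measurable_const
  have hF : Measurable fun p : ℝ × ℝ =>
      (ν (Metric.closedBall p.1 d))⁻¹ * ν (Metric.closedBall p.2 d) :=
    (hf.comp measurable_fst).inv.mul (hf.comp measurable_snd)
  rw [← lintegral_indicator hK, lintegral_prod_symm' _ (hF.indicator hK),
    ← lintegral_const_mul _ hf]
  refine lintegral_mono fun y => ?_
  have hKy : MeasurableSet {x : ℝ | |a * x + b * y| ≤ c} :=
    measurableSet_le (by fun_prop) measurable_const
  calc ∫⁻ x, {p : ℝ × ℝ | |a * p.1 + b * p.2| ≤ c}.indicator (fun p =>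
          (ν (Metric.closedBall p.1 d))⁻¹ * ν (Metric.closedBall p.2 d)) (x, y) ∂ν
      = ∫⁻ x in {x | |a * x + b * y| ≤ c},
          (ν (Metric.closedBall x d))⁻¹ * ν (Metric.closedBall y d) ∂ν := by
        rw [← lintegral_indicator hKy]
        rfl
    _ = (∫⁻ x in {x | |a * x + b * y| ≤ c}, (ν (Metric.closedBall x d))⁻¹ ∂ν) *
          ν (Metric.closedBall y d) := lintegral_mul_const _ hf.inv
    _ ≤ _ := by
        gcongr
        exact setLIntegral_inv_measure_closedBall_abs_le ν _ ha hc hd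

lemma ennreal_two_le_inv_mul_add_mul_inv {u v : ℝ≥0∞} (hu : u ≠ 0) (hv : v ≠ 0) (hu' : u ≠ ∞)
    (hv' : v ≠ ∞) : 2 ≤ u⁻¹ * v + v⁻¹ * u := by
  lift u to NNReal using hu'
  lift v to NNReal using hv'
  rw [ENNReal.coe_ne_zero] at hu hv
  rw [← ENNReal.coe_inv hu, ← ENNReal.coe_inv hv]
  norm_cast
  rw [← NNReal.coe_le_coe]
  have hu0 : (0 : ℝ) < u := by positivity
  have hv0 : (0 : ℝ) < v := by positivity
  push_cast
  rw [inv_mul_eq_div, inv_mul_eq_div, div_add_div _ _ hu0.ne' hv0.ne',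
    le_div_iff₀ (mul_pos hu0 hv0)]
  nlinarith [sq_nonneg ((u : ℝ) - v)]

lemma prod_abs_mul_add_mul_le (ν : Measure ℝ) [IsFiniteMeasure ν]
    {a b c d : ℝ} (ha : a ≠ 0) (hb : b ≠ 0) (hc : 0 < c) (hd : 0 < d) :
    2 * (ν.prod ν) {p | |a * p.1 + b * p.2| ≤ c} ≤
      ((⌈2 * c / (|a| * d)⌉₊ : ℝ≥0∞) + (⌈2 * c / (|b| * d)⌉₊ : ℝ≥0∞)) *
        (ν.prod ν) {p | |p.1 - p.2| ≤ d} := by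
  have hf := measurable_measure_closedBall ν d
  have hD : (ν.prod ν) {p | |p.1 - p.2| ≤ d} = ∫⁻ y, ν (Metric.closedBall y d) ∂ν :=
    Measure.prod_apply_symm (measurableSet_le (by fun_prop) measurable_const)
  have hF : Measurable fun p : ℝ × ℝ =>
      (ν (Metric.closedBall p.1 d))⁻¹ * ν (Metric.closedBall p.2 d) :=
    (hf.comp measurable_fst).inv.mul (hf.comp measurable_snd)
  have hpos := ae_measure_closedBall_ne_zero ν hd
  have hswap : ∫⁻ p in {p : ℝ × ℝ | |a * p.1 + b * p.2| ≤ c},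
        (ν (Metric.closedBall p.2 d))⁻¹ * ν (Metric.closedBall p.1 d) ∂(ν.prod ν) =
      ∫⁻ p in {p : ℝ × ℝ | |b * p.1 + a * p.2| ≤ c},
        (ν (Metric.closedBall p.1 d))⁻¹ * ν (Metric.closedBall p.2 d) ∂(ν.prod ν) := by
    rw [← Measure.measurePreserving_swap.setLIntegral_comp_preimage
      (measurableSet_le (by fun_prop) measurable_const) hF]
    simp only [Set.preimage_ofPred_eq, Prod.fst_swap, Prod.snd_swap, add_comm]
  calc 2 * (ν.prod ν) {p | |a * p.1 + b * p.2| ≤ c}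
      = ∫⁻ _ in {p : ℝ × ℝ | |a * p.1 + b * p.2| ≤ c}, 2 ∂(ν.prod ν) :=
        (setLIntegral_const _ _).symm
    _ ≤ ∫⁻ p in {p : ℝ × ℝ | |a * p.1 + b * p.2| ≤ c},
          ((ν (Metric.closedBall p.1 d))⁻¹ * ν (Metric.closedBall p.2 d) +
          (ν (Metric.closedBall p.2 d))⁻¹ * ν (Metric.closedBall p.1 d)) ∂(ν.prod ν) := by
        refine lintegral_mono_ae (ae_restrict_of_ae ?_)
        filter_upwards [Measure.quasiMeasurePreserving_fst.ae hpos,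
          Measure.quasiMeasurePreserving_snd.ae hpos] with p h1 h2
        exact ennreal_two_le_inv_mul_add_mul_inv h1 h2 (measure_ne_top _ _) (measure_ne_top _ _)
    _ ≤ _ := by
        rw [lintegral_add_left hF, hswap, hD, add_mul]
        exact add_le_add (setLIntegral_prod_inv_mul_measure_closedBall_le ν b ha hc hd)
          (setLIntegral_prod_inv_mul_measure_closedBall_le ν a hb hc hd)

theorem stmt11 {Ω : Type*} [MeasurableSpace Ω] (μ : Measure Ω) [IsProbabilityMeasure μ]
    (a b c d : ℝ) (ha : a ≠ 0) (hb : b ≠ 0) (hc : 0 < c) (hd : 0 < d)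
    (X Y : Ω → ℝ) (hX : Measurable X) (hY : Measurable Y)
    (hid : IdentDistrib X Y μ μ) (hind : IndepFun X Y μ) :
    μ {ω | |a * X ω + b * Y ω| ≤ c} ≤
      (1 / 2) * ((⌈2 * c / (|a| * d)⌉₊ : ℝ≥0∞) + (⌈2 * c / (|b| * d)⌉₊ : ℝ≥0∞)) *
        μ {ω | |X ω - Y ω| ≤ d} := by
  have hlaw : μ.map (fun ω => (X ω, Y ω)) = (μ.map X).prod (μ.map X) := by
    rw [(indepFun_iff_map_prod_eq_prod_map_map hX.aemeasurable hY.aemeasurable).1 hind,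
      hid.map_eq]
  have h := prod_abs_mul_add_mul_le (μ.map X) ha hb hc hd
  rw [← hlaw,
    Measure.map_apply (hX.prodMk hY) (measurableSet_le (by fun_prop) measurable_const),
    Measure.map_apply (hX.prodMk hY) (measurableSet_le (by fun_prop) measurable_const)] at h
  rw [one_div, mul_assoc, ← ENNReal.div_eq_inv_mul,
    ENNReal.le_div_iff_mul_le (Or.inl two_ne_zero) (Or.inl ENNReal.ofNat_ne_top), mul_comm]
  exact h
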